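/- Let (Ω, ℱ, P) be a probability space and 𝒢 ⊆ ℱ a sub-σ-algebra. Fix μ_α ∈ ℝ, μ_δ ∈ ℝᵖ, and vectors x₁, x₂, …, x_{n+1} ∈ ℝᵖ. For i = 2, …, n+1, let δᵢ be integrable random vectors in ℝᵖ with E[δᵢ] = μ_δ (componentwise), let ε̃ᵢ be integrable real random variables with E[ε̃ᵢ] = 0, set αᵢ = μ_α + ⟨δᵢ, xᵢ⟩ + ε̃ᵢ, and let α̂ᵢ be integrable with E[α̂ᵢ | 𝒢] = αᵢ almost surely. If the weights w₂, …, w_{n+1} ≥ 0 satisfy Σᵢ wᵢ = 1 and Σ_{i=2}^{n+1} wᵢ xᵢ = x₁, then E[Σ_{i=2}^{n+1} wᵢ α̂ᵢ] = μ_α + ⟨μ_δ, x₁⟩; that is, under model 𝓜₂₂ the weighted-adjustment estimator is unbiased for E[α₁] = μ_α + ⟨μ_δ, x₁⟩. (Part of Proposition 2(ii) of the paper, for model 𝓜₂₂.) -/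

import Mathlib

open MeasureTheory ProbabilityTheory
open scoped RealInnerProductSpace

/-- The mean of a linear form in a random vector plus a constant and a centred noise term. -/
theorem integral_const_add_inner_add {Ω E : Type*} {mΩ : MeasurableSpace Ω} {μ : Measure Ω}
    [IsProbabilityMeasure μ] [NormedAddCommGroup E] [InnerProductSpace ℝ E] [CompleteSpace E]
    (a : ℝ) (v : E) {X : Ω → E} (hX : Integrable X μ) {e : Ω → ℝ} (he : Integrable e μ)
    (he0 : ∫ ω, e ω ∂μ = 0) :
    ∫ ω, (a + ⟪X ω, v⟫ + e ω) ∂μ = a + ⟪∫ ω, X ω ∂μ, v⟫ := by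
  have hXv : Integrable (fun ω => ⟪X ω, v⟫) μ := hX.inner_const v
  have hmean : ∫ ω, ⟪X ω, v⟫ ∂μ = ⟪∫ ω, X ω ∂μ, v⟫ := by
    simp_rw [real_inner_comm v]
    exact integral_inner hX v
  have haXv : Integrable (fun ω => a + ⟪X ω, v⟫) μ := (integrable_const a).add hXv
  rw [integral_add haXv he, integral_add (integrable_const a) hXv,
    hmean, he0]
  simp

/-- Proposition 2(ii) under model 𝓜₂₂: with random coefficient vectors `δᵢ` of
common mean `μ_δ`, the weighted-adjustment estimator with simplex weights
reproducing `x₁` is unbiased for `E[α₁] = μ_α + ⟨μ_δ, x₁⟩`. -/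
theorem wadj_unbiased_M22
    {Ω : Type*} {mΩ : MeasurableSpace Ω} {μ : Measure Ω} [IsProbabilityMeasure μ]
    {m : MeasurableSpace Ω} (hm : m ≤ mΩ)
    {n p : ℕ} (μα : ℝ) (μδ : EuclideanSpace ℝ (Fin p))
    (x1 : EuclideanSpace ℝ (Fin p)) (x : Fin n → EuclideanSpace ℝ (Fin p))
    (δ : Fin n → Ω → EuclideanSpace ℝ (Fin p))
    (hδint : ∀ i, Integrable (δ i) μ)
    (hδmean : ∀ i, ∫ ω, δ i ω ∂μ = μδ)
    (ε : Fin n → Ω → ℝ) (hεint : ∀ i, Integrable (ε i) μ)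
    (hεmean : ∀ i, ∫ ω, ε i ω ∂μ = 0)
    (α : Fin n → Ω → ℝ)
    (hα : ∀ i ω, α i ω = μα + ⟪δ i ω, x i⟫ + ε i ω)
    (αhat : Fin n → Ω → ℝ) (hinthat : ∀ i, Integrable (αhat i) μ)
    (hcond : ∀ i, μ[αhat i | m] =ᵐ[μ] α i)
    (w : Fin n → ℝ) (hw0 : ∀ i, 0 ≤ w i) (hw1 : ∑ i, w i = 1)
    (hfit : ∑ i, w i • x i = x1) :
    ∫ ω, ∑ i, w i * αhat i ω ∂μ = μα + ⟪μδ, x1⟫ := by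
  have hmean : ∀ i, ∫ ω, αhat i ω ∂μ = μα + ⟪μδ, x i⟫ := fun i => by
    rw [← integral_condExp hm, integral_congr_ae (hcond i), ← hδmean i,
      ← integral_const_add_inner_add μα (x i) (hδint i) (hεint i) (hεmean i)]
    simp_rw [hα]
  rw [integral_finsetSum _ fun i _ => (hinthat i).const_mul (w i), ← hfit, inner_sum]
  simp_rw [integral_const_mul, hmean, mul_add, inner_smul_right]
  rw [Finset.sum_add_distrib, ← Finset.sum_mul, hw1, one_mul]
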